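/- lim_{ν→∞} √ν · exp(√(ν² − ν) − ν·log(√ν + √(ν − 1))) · M(ν, √ν) = √(2/π), where M(ν,z) := √(M²(ν,z)). -/

import Mathlib

open Real MeasureTheory Set Filter

/-- Integral representation of the modified Bessel function `K₀`. -/
noncomputable def K0 (x : ℝ) : ℝ := ∫ t in Ioi (0:ℝ), Real.exp (-x * Real.cosh t)

/-- Bessel modulus squared, via Nicholson's formula. -/
noncomputable def M2 (ν z : ℝ) : ℝ :=
  (8 / π ^ 2) * ∫ t in Ioi (0:ℝ), K0 (2 * z * Real.sinh t) * Real.cosh (2 * ν * t)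

/-- The Bessel modulus. -/
noncomputable def M (ν z : ℝ) : ℝ := Real.sqrt (M2 ν z)

lemma one_add_sq_div_two_le_cosh (s : ℝ) : 1 + s ^ 2 / 2 ≤ Real.cosh s := by
  have h1 : Real.cosh s = 1 + 2 * Real.sinh (s / 2) ^ 2 := by
    have h := Real.cosh_two_mul (s / 2)
    rw [mul_div_cancel₀ s two_ne_zero, Real.cosh_sq] at h
    linarith
  have h2 : |s / 2| ≤ |Real.sinh (s / 2)| := by
    rw [Real.abs_sinh]
    exact Real.self_le_sinh_iff.2 (abs_nonneg _)
  have h3 := sq_le_sq.2 h2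
  rw [h1]
  linarith [h3, div_pow s 2 2]

lemma sinh_le_mul_cosh {b : ℝ} (hb : 0 ≤ b) : Real.sinh b ≤ b * Real.cosh b := by
  have hm : MonotoneOn (fun b : ℝ => b * Real.cosh b - Real.sinh b) (Ici 0) := by
    refine monotoneOn_of_hasDerivWithinAt_nonneg (f' := fun b => b * Real.sinh b) (convex_Ici 0)
      (by fun_prop) (fun x _ => ?_) (fun x hx => ?_)
    · have h := ((hasDerivAt_id x).mul (Real.hasDerivAt_cosh x)).sub (Real.hasDerivAt_sinh x)
      refine HasDerivAt.hasDerivWithinAt (h.congr_deriv ?_)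
      simp
    · rw [interior_Ici] at hx
      exact mul_nonneg hx.le (Real.sinh_nonneg_iff.2 hx.le)
  have h := hm (self_mem_Ici) (mem_Ici.2 hb) hb
  simp only [zero_mul, Real.sinh_zero, sub_zero] at h
  linarith

lemma cosh_sub_one_le {a : ℝ} (ha : 0 ≤ a) : Real.cosh a - 1 ≤ a ^ 2 / 2 * Real.cosh a := by
  have h := Real.cosh_two_mul (a / 2)
  rw [mul_div_cancel₀ a two_ne_zero] at h
  have h2 := Real.cosh_sq (a / 2)
  have h1 := sinh_le_mul_cosh (b := a / 2) (by linarith)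
  have h0 : 0 ≤ Real.sinh (a / 2) := Real.sinh_nonneg_iff.2 (by linarith)
  have h3 := pow_le_pow_left₀ h0 h1 2
  have h4 : Real.cosh (a / 2) ^ 2 ≤ Real.cosh a := by rw [h]; nlinarith
  nlinarith [mul_le_mul_of_nonneg_left h4 (sq_nonneg a)]

lemma sq_div_two_add_le_exp_neg {a : ℝ} (ha : 0 ≤ a) :
    a ^ 2 / (2 + a) ≤ Real.exp (-a) - 1 + a := by
  have h1 := sinh_le_mul_cosh (b := a / 2) (by linarith)
  rw [Real.sinh_eq, Real.cosh_eq] at h1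
  have e1 : Real.exp (-a) = Real.exp (-(a / 2)) * Real.exp (-(a / 2)) := by
    rw [← Real.exp_add]; ring_nf
  have e2 : Real.exp (a / 2) * Real.exp (-(a / 2)) = 1 := by
    rw [← Real.exp_add]; simp
  rw [div_le_iff₀ (by linarith)]
  have h2 := mul_le_mul_of_nonneg_right h1 (Real.exp_pos (-(a / 2))).le
  nlinarith

lemma exp_neg_mul_cosh_le {x : ℝ} (hx : 0 ≤ x) (s : ℝ) :
    Real.exp (-x * Real.cosh s) ≤ Real.exp (-x) * Real.exp (-(x / 2) * s ^ 2) := by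
  rw [← Real.exp_add]
  refine Real.exp_le_exp.2 ?_
  nlinarith [one_add_sq_div_two_le_cosh s]

lemma measurable_K0 : Measurable K0 := by
  have h : StronglyMeasurable (Function.uncurry fun x t : ℝ => Real.exp (-x * Real.cosh t)) := by
    apply Continuous.stronglyMeasurable
    unfold Function.uncurry
    fun_prop
  exact (StronglyMeasurable.integral_prod_right (ν := volume.restrict (Ioi (0:ℝ))) h).measurable

lemma K0_nonneg (x : ℝ) : 0 ≤ K0 x := integral_nonneg fun _ => (Real.exp_pos _).le

lemma K0_le {x : ℝ} (hx : 0 < x) : K0 x ≤ Real.exp (-x) * √(π / (2 * x)) := by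
  have hg : Integrable fun s : ℝ => Real.exp (-x) * Real.exp (-(x / 2) * s ^ 2) :=
    (integrable_exp_neg_mul_sq (by positivity)).const_mul _
  have h : K0 x ≤ ∫ s in Ioi (0:ℝ), Real.exp (-x) * Real.exp (-(x / 2) * s ^ 2) := by
    refine integral_mono_of_nonneg (ae_of_all _ fun _ => (Real.exp_pos _).le) hg.integrableOn
      (ae_of_all _ fun s => exp_neg_mul_cosh_le hx.le s)
  rw [integral_const_mul, integral_gaussian_Ioi] at h
  refine h.trans_eq ?_
  congr 1
  rw [show π / (2 * x) = π / (x / 2) / 2 ^ 2 by field_simp,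
    Real.sqrt_div' _ (sq_nonneg (2:ℝ)), Real.sqrt_sq (by norm_num)]

lemma tendsto_mul_exp_div_sqrt (x : ℝ) :
    Tendsto (fun ν : ℝ => ν * (Real.exp (x / √ν) - 1 - x / √ν)) atTop (nhds (x ^ 2 / 2)) := by
  have h0 : Tendsto (fun ν : ℝ => x / √ν) atTop (nhds 0) :=
    Real.tendsto_sqrt_atTop.const_div_atTop x
  have h1 := (Real.exp_sub_sum_range_succ_isLittleO_pow 2).comp_tendsto h0
  have h2 : Tendsto (fun ν : ℝ => ν * (Real.exp (x / √ν) - 1 - x / √ν - (x / √ν) ^ 2 / 2)) atTop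
      (nhds 0) := by
    rw [← Asymptotics.isLittleO_one_iff ℝ]
    have h3 := (Asymptotics.isBigO_refl (fun ν : ℝ => ν) atTop).mul_isLittleO h1
    have h4 : (fun ν : ℝ => ν * ((fun y : ℝ => y ^ 2) ∘ fun ν => x / √ν) ν) =O[atTop]
        fun _ => (1 : ℝ) := by
      refine Asymptotics.IsBigO.of_bound (x ^ 2) ?_
      filter_upwards [eventually_gt_atTop 0] with ν hν
      have : ν * (x / √ν) ^ 2 = x ^ 2 := by
        rw [div_pow, Real.sq_sqrt hν.le]; field_simp
      simp [this]
    refine (h3.trans_isBigO h4).congr_left fun ν => ?_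
    simp only [Finset.sum_range_succ, Function.comp]
    norm_num [Nat.factorial]
    left
    ring
  have h5 := h2.add_const (x ^ 2 / 2)
  rw [zero_add] at h5
  refine h5.congr' ?_
  filter_upwards [eventually_gt_atTop 0] with ν hν
  have : ν * (x / √ν) ^ 2 = x ^ 2 := by
    rw [div_pow, Real.sq_sqrt hν.le]; field_simp
  linear_combination (-1 / 2) * this

lemma tendsto_mul_cosh_div_sqrt (x : ℝ) :
    Tendsto (fun ν : ℝ => ν * (Real.cosh (x / √ν) - 1)) atTop (nhds (x ^ 2 / 2)) := by
  have h := ((tendsto_mul_exp_div_sqrt x).add (tendsto_mul_exp_div_sqrt (-x))).div_const 2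
  rw [show (x ^ 2 / 2 + (-x) ^ 2 / 2) / 2 = x ^ 2 / 2 by ring] at h
  refine h.congr fun ν => ?_
  rw [Real.cosh_eq, neg_div]
  ring

lemma tendsto_mul_sinh_div_sqrt (x : ℝ) :
    Tendsto (fun ν : ℝ => ν * (Real.sinh (x / √ν) - x / √ν)) atTop (nhds 0) := by
  have h := ((tendsto_mul_exp_div_sqrt x).sub (tendsto_mul_exp_div_sqrt (-x))).div_const 2
  rw [show (x ^ 2 / 2 - (-x) ^ 2 / 2) / 2 = 0 by ring] at h
  refine h.congr fun ν => ?_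
  rw [Real.sinh_eq, neg_div]
  ring

lemma tendsto_K0_mul_exp_mul_sqrt :
    Tendsto (fun x : ℝ => K0 x * Real.exp x * √x) atTop (nhds √(π / 2)) := by
  have h : Tendsto (fun x : ℝ => ∫ y in Ioi (0:ℝ), Real.exp (-(x * (Real.cosh (y / √x) - 1)))) atTop
      (nhds (∫ y in Ioi (0:ℝ), Real.exp (-(1 / 2) * y ^ 2))) := by
    refine tendsto_integral_filter_of_dominated_convergence
      (fun y => Real.exp (-(1 / 2) * y ^ 2)) (Eventually.of_forall fun x => ?_) ?_
      (integrable_exp_neg_mul_sq (by norm_num)).integrableOn (ae_of_all _ fun y => ?_)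
    · exact Continuous.aestronglyMeasurable (by fun_prop)
    · filter_upwards [eventually_gt_atTop 0] with x hx
      refine ae_of_all _ fun y => ?_
      rw [Real.norm_of_nonneg (Real.exp_pos _).le]
      refine Real.exp_le_exp.2 ?_
      have h1 := one_add_sq_div_two_le_cosh (y / √x)
      have h2 : x * (y / √x) ^ 2 = y ^ 2 := by
        rw [div_pow, Real.sq_sqrt hx.le]; field_simp
      nlinarith [mul_le_mul_of_nonneg_left h1 hx.le]
    · have := (Real.continuous_exp.tendsto _).comp (tendsto_mul_cosh_div_sqrt y).neg
      rwa [show -(1 / 2) * y ^ 2 = -(y ^ 2 / 2) by ring]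
  rw [integral_gaussian_Ioi] at h
  have e : √(π / (1 / 2)) / 2 = √(π / 2) := by
    rw [show π / 2 = π / (1 / 2) / 2 ^ 2 by ring,
      Real.sqrt_div' _ (sq_nonneg (2:ℝ)), Real.sqrt_sq (by norm_num)]
  rw [e] at h
  refine h.congr' ?_
  filter_upwards [eventually_gt_atTop 0] with x hx
  have hs : 0 < √x := Real.sqrt_pos.2 hx
  have h1 := integral_comp_mul_left_Ioi
    (fun s => Real.exp (-(x * (Real.cosh s - 1)))) 0 (inv_pos.2 hs)
  simp only [mul_zero, inv_inv, smul_eq_mul] at h1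
  simp only [div_eq_inv_mul]
  rw [h1, K0, mul_comm √x]
  congr 1
  rw [← integral_mul_const]
  refine integral_congr_ae (ae_of_all _ fun s => ?_)
  simp only
  rw [← Real.exp_add]
  ring_nf

/-- The saddle point `arcosh √ν`. -/
noncomputable def saddle (ν : ℝ) : ℝ := Real.log (√ν + √(ν - 1))

lemma exp_saddle {ν : ℝ} (hν : 1 ≤ ν) : Real.exp (saddle ν) = √ν + √(ν - 1) :=
  Real.exp_log (add_pos_of_pos_of_nonneg (Real.sqrt_pos.2 (by linarith)) (Real.sqrt_nonneg _))

lemma exp_neg_saddle {ν : ℝ} (hν : 1 ≤ ν) : Real.exp (-saddle ν) = √ν - √(ν - 1) := by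
  rw [Real.exp_neg, exp_saddle hν]
  refine (eq_inv_of_mul_eq_one_right ?_).symm
  nlinarith [Real.sq_sqrt (show 0 ≤ ν by linarith), Real.sq_sqrt (show 0 ≤ ν - 1 by linarith)]

lemma cosh_saddle {ν : ℝ} (hν : 1 ≤ ν) : Real.cosh (saddle ν) = √ν := by
  rw [Real.cosh_eq, exp_saddle hν, exp_neg_saddle hν]
  ring

lemma sinh_saddle {ν : ℝ} (hν : 1 ≤ ν) : Real.sinh (saddle ν) = √(ν - 1) := by
  rw [Real.sinh_eq, exp_saddle hν, exp_neg_saddle hν]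
  ring

lemma tendsto_saddle : Tendsto saddle atTop atTop :=
  Real.tendsto_log_atTop.comp <|
    tendsto_atTop_mono (fun _ => le_add_of_nonneg_right (Real.sqrt_nonneg _))
      Real.tendsto_sqrt_atTop

lemma eventually_two_add_saddle_le : ∀ᶠ ν : ℝ in atTop, 2 + saddle ν ≤ √ν := by
  have h := Real.tendsto_sqrt_atTop.eventually
    (Real.isLittleO_log_id_atTop.bound (show (0:ℝ) < 1 / 2 by norm_num))
  filter_upwards [h, eventually_ge_atTop 36] with ν h1 hν
  have h6 : 6 ≤ √ν := Real.le_sqrt_of_sq_le (by linarith)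
  have hle : saddle ν ≤ Real.log (2 * √ν) := by
    refine Real.log_le_log (by positivity) ?_
    linarith [Real.sqrt_le_sqrt (show ν - 1 ≤ ν by linarith)]
  rw [Real.log_mul (by norm_num) (by positivity)] at hle
  rw [id, Real.norm_of_nonneg (Real.sqrt_nonneg ν)] at h1
  have := (le_abs_self _).trans h1
  linarith [Real.log_two_lt_d9]

lemma sqrt_sq_sub_self {ν : ℝ} (hν : 1 ≤ ν) : √(ν ^ 2 - ν) = √ν * √(ν - 1) := by
  rw [← Real.sqrt_mul (by linarith)]
  ring_nf

lemma phase_eq {ν : ℝ} (hν : 1 ≤ ν) (δ : ℝ) :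
    2 * (√(ν ^ 2 - ν) - ν * saddle ν) + (2 * ν * (saddle ν + δ) -
      2 * √ν * Real.sinh (saddle ν + δ)) =
      2 * ν * (δ - Real.sinh δ) - 2 * √(ν ^ 2 - ν) * (Real.cosh δ - 1) := by
  rw [Real.sinh_add, cosh_saddle hν, sinh_saddle hν, sqrt_sq_sub_self hν]
  have := Real.mul_self_sqrt (show 0 ≤ ν by linarith)
  linear_combination (-2 * Real.sinh δ) * this

lemma phase_le {ν x : ℝ} (hν : 2 ≤ ν) (hs : 2 + saddle ν ≤ √ν) (hx : -saddle ν ≤ x / √ν) :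
    2 * ν * (x / √ν - Real.sinh (x / √ν)) - 2 * √(ν ^ 2 - ν) * (Real.cosh (x / √ν) - 1)
      ≤ 2 - |x| := by
  have hpos : 0 < √ν := Real.sqrt_pos.2 (by linarith)
  have hsq : √ν ^ 2 = ν := Real.sq_sqrt (by linarith)
  have hw0 := Real.sqrt_nonneg (ν ^ 2 - ν)
  have hw2 : √(ν ^ 2 - ν) ^ 2 = ν ^ 2 - ν := Real.sq_sqrt (by nlinarith)
  set w := √(ν ^ 2 - ν)
  have hx2 : ν * (x / √ν) ^ 2 = x ^ 2 := by
    rw [div_pow, hsq]; field_simp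
  have hxδ : x = √ν * (x / √ν) := by field_simp
  generalize x / √ν = δ at *
  rcases le_total 0 δ with h | h
  · have h1 := Real.self_le_sinh_iff.2 h
    have h2 := one_add_sq_div_two_le_cosh δ
    have hw : ν / 2 ≤ w := abs_le_of_sq_le_sq' (by nlinarith) hw0 |>.2
    have h3 : ν * (δ ^ 2 / 2) ≤ 2 * w * (Real.cosh δ - 1) :=
      mul_le_mul (by linarith) (by linarith) (by positivity) (by linarith)
    have h4 : |x| ≤ 2 + x ^ 2 / 2 := by
      rw [← sq_abs]; nlinarith [sq_nonneg (|x| - 1)]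
    nlinarith
  · obtain ⟨a, rfl⟩ : ∃ a, δ = -a := ⟨-δ, by ring⟩
    have ha : 0 ≤ a := by linarith
    have hax : |x| = √ν * a := by
      rw [hxδ, abs_mul, abs_of_pos hpos, abs_neg, abs_of_nonneg ha]
    have h1 := sq_div_two_add_le_exp_neg ha
    have h2 := cosh_sub_one_le ha
    have h3 : Real.cosh a ≤ √ν := by
      rw [← cosh_saddle (by linarith : 1 ≤ ν), Real.cosh_le_cosh, abs_of_nonneg ha]
      exact (by linarith : a ≤ saddle ν).trans (le_abs_self _)
    have hw : ν - w ≤ 1 := by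
      have : ν - 1 ≤ w := Real.le_sqrt_of_sq_le (by nlinarith)
      linarith
    have hc := Real.one_le_cosh a
    have e : Real.exp (-a) = Real.cosh a - Real.sinh a := (Real.cosh_sub_sinh a).symm
    rw [Real.sinh_neg, Real.cosh_neg]
    have h5 : 2 * (ν - w) * (Real.cosh a - 1) ≤ a ^ 2 * √ν := by
      have : (ν - w) * (Real.cosh a - 1) ≤ 1 * (Real.cosh a - 1) :=
        mul_le_mul_of_nonneg_right hw (by linarith)
      nlinarith [mul_le_mul_of_nonneg_left h3 (sq_nonneg a)]
    have h6 : a ^ 2 * √ν ≤ ν * (a ^ 2 / (2 + a)) := by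
      rw [← mul_div_assoc, le_div_iff₀ (by linarith)]
      have : √ν * (2 + a) ≤ ν := by nlinarith
      nlinarith [mul_le_mul_of_nonneg_left this (sq_nonneg a)]
    have h7 : |x| - 2 ≤ ν * (a ^ 2 / (2 + a)) := by
      rw [← mul_div_assoc, le_div_iff₀ (by linarith)]
      have h1x : a ≤ |x| := by
        rw [hax]
        have : 1 ≤ √ν := Real.one_le_sqrt.2 (by linarith)
        nlinarith
      have : ν * a ^ 2 = |x| ^ 2 := by rw [hax, mul_pow, hsq]
      nlinarith [mul_nonneg ha (abs_nonneg x)]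
    have h8 := mul_le_mul_of_nonneg_left h1 (show 0 ≤ ν by linarith)
    rw [e] at h8
    linarith

/-- The integrand of Nicholson's formula at `z = √ν`. -/
noncomputable def nicholson (ν t : ℝ) : ℝ :=
  K0 (2 * √ν * Real.sinh t) * Real.cosh (2 * ν * t)

lemma nicholson_nonneg (ν t : ℝ) : 0 ≤ nicholson ν t :=
  mul_nonneg (K0_nonneg _) (Real.cosh_pos _).le

lemma measurable_nicholson (ν : ℝ) : Measurable (nicholson ν) :=
  (measurable_K0.comp (by fun_prop)).mul (by fun_prop)

lemma nicholson_le {ν t : ℝ} (hν : 0 < ν) (ht : 0 < t) :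
    nicholson ν t ≤ √(π / (4 * √ν * Real.sinh t)) *
      Real.exp (2 * ν * t - 2 * √ν * Real.sinh t) := by
  have hs := Real.sinh_pos_iff.2 ht
  have hr := Real.sqrt_pos.2 hν
  have h1 := K0_le (x := 2 * √ν * Real.sinh t) (by positivity)
  have h2 : Real.cosh (2 * ν * t) ≤ Real.exp (2 * ν * t) := by
    rw [← Real.cosh_add_sinh]
    linarith [Real.sinh_pos_iff.2 (show 0 < 2 * ν * t by positivity)]
  refine (mul_le_mul h1 h2 (Real.cosh_pos _).le (by positivity)).trans_eq ?_
  rw [sub_eq_add_neg, Real.exp_add, show 2 * (2 * √ν * Real.sinh t) = 4 * √ν * Real.sinh t by ring]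
  ring

/-- The rescaled contribution of `t > 1` to Nicholson's integral. -/
noncomputable def rescaled (ν x : ℝ) : ℝ :=
  √ν * Real.exp (2 * (√(ν ^ 2 - ν) - ν * saddle ν)) *
    (Ioi 1).indicator (nicholson ν) (saddle ν + x / √ν)

lemma measurable_rescaled (ν : ℝ) : Measurable (rescaled ν) :=
  measurable_const.mul (((measurable_nicholson ν).indicator measurableSet_Ioi).comp (by fun_prop))

lemma rescaled_nonneg (ν x : ℝ) : 0 ≤ rescaled ν x :=
  mul_nonneg (by positivity) (indicator_nonneg (fun _ _ => nicholson_nonneg _ _) _)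

lemma exp_le_four_mul_sinh {t : ℝ} (ht : 1 ≤ t) : Real.exp t ≤ 4 * Real.sinh t := by
  rw [Real.sinh_eq]
  have h1 : Real.exp (-t) ≤ 1 := Real.exp_le_one_iff.2 (by linarith)
  have h2 := Real.add_one_le_exp t
  linarith

lemma rescaled_le {ν : ℝ} (hν : 2 ≤ ν) (hs : 2 + saddle ν ≤ √ν) (x : ℝ) :
    rescaled ν x ≤ √π * Real.exp 2 * Real.exp (-(1 / 2) * |x|) := by
  unfold rescaled
  by_cases ht : 1 < saddle ν + x / √ν
  swap
  · rw [indicator_of_notMem (by simpa using ht), mul_zero]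
    positivity
  rw [indicator_of_mem (mem_Ioi.2 ht)]
  have hr : 0 < √ν := Real.sqrt_pos.2 (by linarith)
  have h1 := nicholson_le (ν := ν) (by linarith) (zero_lt_one.trans ht)
  have hsh := Real.sinh_pos_iff.2 (zero_lt_one.trans ht)
  have h2 := phase_le (x := x) hν hs (by linarith)
  rw [← phase_eq (by linarith)] at h2
  have h3 : √ν * √(π / (4 * √ν * Real.sinh (saddle ν + x / √ν))) ≤
      √π * Real.exp (|x| / 2) := by
    have h4 : √ν ≤ Real.exp |x| * (4 * Real.sinh (saddle ν + x / √ν)) := by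
      refine le_trans ?_ (mul_le_mul_of_nonneg_left (exp_le_four_mul_sinh ht.le) (by positivity))
      rw [← Real.exp_add]
      have h5 : √ν ≤ Real.exp (saddle ν) := by
        rw [exp_saddle (by linarith)]; linarith [Real.sqrt_nonneg (ν - 1)]
      refine h5.trans (Real.exp_le_exp.2 ?_)
      have h6 : |x / √ν| ≤ |x| := by
        rw [abs_div, abs_of_pos hr]
        exact div_le_self (abs_nonneg _) (Real.one_le_sqrt.2 (by linarith))
      linarith [neg_abs_le (x / √ν)]
    have h7 : Real.exp (|x| / 2) = √(Real.exp |x|) := by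
      rw [Real.exp_half]
    rw [h7, ← Real.sqrt_mul Real.pi_pos.le, ← Real.sqrt_sq hr.le, ← Real.sqrt_mul (sq_nonneg _),
      Real.sqrt_sq hr.le]
    refine Real.sqrt_le_sqrt ?_
    rw [← mul_div_assoc, div_le_iff₀ (by positivity)]
    nlinarith [mul_le_mul_of_nonneg_left h4 (mul_nonneg Real.pi_pos.le hr.le)]
  calc _ ≤ √ν * Real.exp (2 * (√(ν ^ 2 - ν) - ν * saddle ν)) * _ :=
        mul_le_mul_of_nonneg_left h1 (by positivity)
    _ = (√ν * √(π / (4 * √ν * Real.sinh (saddle ν + x / √ν)))) *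
        Real.exp (2 * (√(ν ^ 2 - ν) - ν * saddle ν) + (2 * ν * (saddle ν + x / √ν) -
          2 * √ν * Real.sinh (saddle ν + x / √ν))) := by
        rw [Real.exp_add]; ring
    _ ≤ (√π * Real.exp (|x| / 2)) * Real.exp (2 - |x|) :=
        mul_le_mul h3 (Real.exp_le_exp.2 h2) (by positivity) (by positivity)
    _ = _ := by
        rw [mul_assoc, mul_assoc, ← Real.exp_add, ← Real.exp_add]
        ring_nf

lemma integrable_exp_neg_half_mul_abs : Integrable fun x : ℝ => Real.exp (-(1 / 2) * |x|) := by
  refine Integrable.of_integral_ne_zero ?_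
  rw [integral_comp_abs (f := fun x => Real.exp (-(1 / 2) * x)),
    integral_exp_mul_Ioi (by norm_num)]
  norm_num

lemma tendsto_sqrt_sub_one_div_sqrt :
    Tendsto (fun ν : ℝ => √(ν - 1) / √ν) atTop (nhds 1) := by
  have h1 : Tendsto (fun ν : ℝ => 1 - 1 / ν) atTop (nhds (1 - 0)) :=
    tendsto_const_nhds.sub (tendsto_const_nhds.div_atTop tendsto_id)
  have h2 := (Real.continuous_sqrt.tendsto _).comp h1
  rw [sub_zero, Real.sqrt_one] at h2
  refine h2.congr' ?_
  filter_upwards [eventually_gt_atTop 0] with ν hν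
  rw [← Real.sqrt_div' _ hν.le, Function.comp, sub_div, div_self hν.ne']

lemma tendsto_div_sqrt (x : ℝ) : Tendsto (fun ν : ℝ => x / √ν) atTop (nhds 0) :=
  Real.tendsto_sqrt_atTop.const_div_atTop x

lemma tendsto_sinh_saddle_add_div (x : ℝ) :
    Tendsto (fun ν : ℝ => Real.sinh (saddle ν + x / √ν) / √ν) atTop (nhds 1) := by
  have hc := (Real.continuous_cosh.tendsto _).comp (tendsto_div_sqrt x)
  have hs := (Real.continuous_sinh.tendsto _).comp (tendsto_div_sqrt x)
  have h := (tendsto_sqrt_sub_one_div_sqrt.mul hc).add hs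
  rw [Real.cosh_zero, Real.sinh_zero, mul_one, add_zero] at h
  refine h.congr' ?_
  filter_upwards [eventually_ge_atTop 1] with ν hν
  have : 0 < √ν := Real.sqrt_pos.2 (by linarith)
  rw [Real.sinh_add, cosh_saddle hν, sinh_saddle hν]
  simp only [Function.comp]
  field_simp

lemma tendsto_phase (x : ℝ) :
    Tendsto (fun ν : ℝ => 2 * ν * (x / √ν - Real.sinh (x / √ν)) -
      2 * √(ν ^ 2 - ν) * (Real.cosh (x / √ν) - 1)) atTop (nhds (-x ^ 2)) := by
  have h := ((tendsto_mul_sinh_div_sqrt x).const_mul (-2)).sub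
    ((tendsto_sqrt_sub_one_div_sqrt.mul (tendsto_mul_cosh_div_sqrt x)).const_mul 2)
  rw [show -2 * 0 - 2 * (1 * (x ^ 2 / 2)) = -x ^ 2 by ring] at h
  refine h.congr' ?_
  filter_upwards [eventually_ge_atTop 1] with ν hν
  have h0 : 0 < √ν := Real.sqrt_pos.2 (by linarith)
  have h1 : √(ν - 1) / √ν * ν = √(ν ^ 2 - ν) := by
    rw [sqrt_sq_sub_self hν, div_mul_eq_mul_div, div_eq_iff h0.ne']
    linear_combination (-√(ν - 1)) * Real.mul_self_sqrt (show 0 ≤ ν by linarith)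
  rw [← h1]
  ring

lemma tendsto_saddle_add (x : ℝ) :
    Tendsto (fun ν : ℝ => saddle ν + x / √ν) atTop atTop :=
  tendsto_saddle.atTop_add (tendsto_div_sqrt x)

lemma tendsto_rescaled (x : ℝ) :
    Tendsto (fun ν => rescaled ν x) atTop (nhds (√π / 4 * Real.exp (-1 * x ^ 2))) := by
  have hX : Tendsto (fun ν : ℝ => 2 * √ν * Real.sinh (saddle ν + x / √ν)) atTop atTop := by
    have h := (tendsto_sinh_saddle_add_div x).pos_mul_atTop one_pos
      (tendsto_id.const_mul_atTop (show (0:ℝ) < 2 by norm_num))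
    refine h.congr' ?_
    filter_upwards [eventually_gt_atTop 0] with ν hν
    have h0 : 0 < √ν := Real.sqrt_pos.2 hν
    rw [id, div_mul_eq_mul_div, div_eq_iff h0.ne']
    linear_combination (-2 * Real.sinh (saddle ν + x / √ν)) * Real.mul_self_sqrt hν.le
  have hK := tendsto_K0_mul_exp_mul_sqrt.comp hX
  have hratio : Tendsto (fun ν : ℝ => √((2 * (Real.sinh (saddle ν + x / √ν) / √ν))⁻¹)) atTop
      (nhds √(2 * 1)⁻¹) :=
    (((tendsto_sinh_saddle_add_div x).const_mul 2).inv₀ (by norm_num)).sqrt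
  have hcosh : Tendsto (fun ν : ℝ => (1 + Real.exp (-(4 * ν * (saddle ν + x / √ν)))) / 2) atTop
      (nhds ((1 + 0) / 2)) := by
    refine (tendsto_const_nhds.add ?_).div_const 2
    refine Real.tendsto_exp_neg_atTop_nhds_zero.comp ?_
    exact (tendsto_id.const_mul_atTop (by norm_num)).atTop_mul_atTop₀ (tendsto_saddle_add x)
  have hexp := (Real.continuous_exp.tendsto _).comp (tendsto_phase x)
  have h := ((hK.mul hratio).mul hcosh).mul hexp
  have e : √(π / 2) * √(2 * 1)⁻¹ * ((1 + 0) / 2) * Real.exp (-x ^ 2) =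
      √π / 4 * Real.exp (-1 * x ^ 2) := by
    rw [← Real.sqrt_mul (by positivity), show π / 2 * (2 * 1)⁻¹ = π / 2 ^ 2 by ring,
      Real.sqrt_div' _ (sq_nonneg (2:ℝ)), Real.sqrt_sq (by norm_num), neg_one_mul]
    ring
  rw [e] at h
  refine h.congr' ?_
  filter_upwards [eventually_ge_atTop 1, (tendsto_saddle_add x).eventually_gt_atTop 1]
    with ν hν ht
  simp only [Function.comp]
  rw [rescaled, indicator_of_mem (mem_Ioi.2 ht), nicholson, ← phase_eq hν]
  have hr : 0 < √ν := Real.sqrt_pos.2 (by linarith)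
  have hsh := Real.sinh_pos_iff.2 (zero_lt_one.trans ht)
  set t := saddle ν + x / √ν
  have h1 : √(2 * √ν * Real.sinh t) * √((2 * (Real.sinh t / √ν))⁻¹) = √ν := by
    rw [← Real.sqrt_mul (by positivity)]
    congr 1
    have := Real.mul_self_sqrt (show 0 ≤ ν by linarith)
    field_simp
    linarith
  have h2 : Real.cosh (2 * ν * t) =
      (1 + Real.exp (-(4 * ν * t))) / 2 * Real.exp (2 * ν * t) := by
    rw [Real.cosh_eq, div_mul_eq_mul_div, add_mul, ← Real.exp_add]
    ring_nf
  rw [h2, Real.exp_add, Real.exp_sub]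
  have h3 := Real.exp_ne_zero (2 * √ν * Real.sinh t)
  calc _ = K0 (2 * √ν * Real.sinh t) *
        (√(2 * √ν * Real.sinh t) * √((2 * (Real.sinh t / √ν))⁻¹)) *
        ((1 + Real.exp (-(4 * ν * t))) / 2) *
        (Real.exp (2 * (√(ν ^ 2 - ν) - ν * saddle ν)) * Real.exp (2 * ν * t)) := by
        field_simp
    _ = _ := by rw [h1]; ring

lemma tendsto_integral_rescaled :
    Tendsto (fun ν => ∫ x, rescaled ν x) atTop (nhds (π / 4)) := by
  have h : Tendsto (fun ν => ∫ x, rescaled ν x) atTop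
      (nhds (∫ x : ℝ, √π / 4 * Real.exp (-1 * x ^ 2))) := by
    refine tendsto_integral_filter_of_dominated_convergence
      (fun x => √π * Real.exp 2 * Real.exp (-(1 / 2) * |x|))
      (Eventually.of_forall fun ν => (measurable_rescaled ν).aestronglyMeasurable) ?_
      (integrable_exp_neg_half_mul_abs.const_mul _) (ae_of_all _ tendsto_rescaled)
    filter_upwards [eventually_ge_atTop 2, eventually_two_add_saddle_le] with ν hν hs
    refine ae_of_all _ fun x => ?_
    rw [Real.norm_of_nonneg (rescaled_nonneg ν x)]
    exact rescaled_le hν hs x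
  rw [integral_const_mul, integral_gaussian, div_one, div_mul_eq_mul_div,
    Real.mul_self_sqrt Real.pi_pos.le] at h
  exact h

lemma integrable_rescaled {ν : ℝ} (hν : 2 ≤ ν) (hs : 2 + saddle ν ≤ √ν) :
    Integrable (rescaled ν) := by
  refine (integrable_exp_neg_half_mul_abs.const_mul (√π * Real.exp 2)).mono'
    (measurable_rescaled ν).aestronglyMeasurable (ae_of_all _ fun x => ?_)
  rw [Real.norm_of_nonneg (rescaled_nonneg ν x)]
  exact rescaled_le hν hs x

lemma integrableOn_nicholson_Ioi_one {ν : ℝ} (hν : 2 ≤ ν) (hs : 2 + saddle ν ≤ √ν) :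
    IntegrableOn (nicholson ν) (Ioi 1) := by
  have hr : 0 < √ν := Real.sqrt_pos.2 (by linarith)
  have hc : √ν * Real.exp (2 * (√(ν ^ 2 - ν) - ν * saddle ν)) ≠ 0 := by positivity
  have h := ((integrable_const_mul_iff hc.isUnit _).1 (integrable_rescaled hν hs)).comp_mul_left'
    hr.ne'
  simp only [mul_div_cancel_left₀ _ hr.ne'] at h
  have h2 := h.comp_sub_right (saddle ν)
  simp only [add_sub_cancel] at h2
  exact (integrable_indicator_iff measurableSet_Ioi).1 h2

lemma integral_rescaled {ν : ℝ} (hν : 0 < ν) :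
    ∫ x, rescaled ν x = ν * Real.exp (2 * (√(ν ^ 2 - ν) - ν * saddle ν)) *
      ∫ t in Ioi 1, nicholson ν t := by
  have hr : 0 < √ν := Real.sqrt_pos.2 hν
  unfold rescaled
  rw [integral_const_mul,
    Measure.integral_comp_div (fun y => (Ioi 1).indicator (nicholson ν) (saddle ν + y)) √ν,
    integral_add_left_eq_self, integral_indicator measurableSet_Ioi, smul_eq_mul, abs_of_pos hr]
  linear_combination (Real.exp (2 * (√(ν ^ 2 - ν) - ν * saddle ν)) *
    ∫ t in Ioi 1, nicholson ν t) * Real.mul_self_sqrt hν.le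

lemma nicholson_le_rpow {ν t : ℝ} (hν : 1 ≤ ν) (ht : t ∈ Ioc (0:ℝ) 1) :
    nicholson ν t ≤ Real.exp (2 * ν) * t ^ (-(1 / 2) : ℝ) := by
  have hsh := Real.self_le_sinh_iff.2 ht.1.le
  have hsh0 := Real.sinh_pos_iff.2 ht.1
  have hr : 1 ≤ √ν := Real.one_le_sqrt.2 hν
  refine (nicholson_le (by linarith) ht.1).trans ?_
  rw [mul_comm (Real.exp _), Real.rpow_neg ht.1.le, ← Real.sqrt_eq_rpow, ← Real.sqrt_inv]
  refine mul_le_mul (Real.sqrt_le_sqrt ?_) (Real.exp_le_exp.2 ?_) (by positivity) (by positivity)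
  · rw [inv_eq_one_div, div_le_div_iff₀ (by positivity) ht.1]
    nlinarith [Real.pi_le_four, ht.1, mul_le_mul hr hsh ht.1.le (by linarith)]
  · have : 0 ≤ 2 * √ν * Real.sinh t := by positivity
    nlinarith [ht.2]

lemma integrableOn_rpow_neg_half : IntegrableOn (fun t : ℝ => t ^ (-(1 / 2) : ℝ)) (Ioc 0 1) := by
  have := intervalIntegral.intervalIntegrable_rpow' (a := 0) (b := 1) (r := -(1 / 2))
    (by norm_num)
  rwa [intervalIntegrable_iff_integrableOn_Ioc_of_le zero_le_one] at this

lemma integrableOn_nicholson_Ioc {ν : ℝ} (hν : 1 ≤ ν) :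
    IntegrableOn (nicholson ν) (Ioc 0 1) := by
  refine (integrableOn_rpow_neg_half.const_mul (Real.exp (2 * ν))).mono'
    (measurable_nicholson ν).aestronglyMeasurable ?_
  filter_upwards [ae_restrict_mem measurableSet_Ioc] with t ht
  rw [Real.norm_of_nonneg (nicholson_nonneg ν t)]
  exact nicholson_le_rpow hν ht

lemma integral_nicholson_Ioc_le {ν : ℝ} (hν : 1 ≤ ν) :
    ∫ t in Ioc 0 1, nicholson ν t ≤
      Real.exp (2 * ν) * ∫ t in Ioc (0:ℝ) 1, t ^ (-(1 / 2) : ℝ) := by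
  rw [← integral_const_mul]
  exact setIntegral_mono_on (integrableOn_nicholson_Ioc hν)
    (integrableOn_rpow_neg_half.const_mul _) measurableSet_Ioc fun t ht => nicholson_le_rpow hν ht

lemma tendsto_integral_nicholson_Ioc :
    Tendsto (fun ν => ν * Real.exp (2 * (√(ν ^ 2 - ν) - ν * saddle ν)) *
      ∫ t in Ioc 0 1, nicholson ν t) atTop (nhds 0) := by
  have h0 : Tendsto (fun ν : ℝ => ν * Real.exp (-ν) *
      ∫ t in Ioc (0:ℝ) 1, t ^ (-(1 / 2) : ℝ)) atTop (nhds 0) := by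
    have := (Real.tendsto_pow_mul_exp_neg_atTop_nhds_zero 1).mul_const
      (∫ t in Ioc (0:ℝ) 1, t ^ (-(1 / 2) : ℝ))
    simpa using this
  refine squeeze_zero' ?_ ?_ h0
  · filter_upwards [eventually_ge_atTop 0] with ν hν
    exact mul_nonneg (by positivity) (integral_nonneg fun t => nicholson_nonneg ν t)
  · filter_upwards [eventually_ge_atTop 1, tendsto_saddle.eventually_ge_atTop 3] with ν hν hs
    have hI : 0 ≤ ∫ t in Ioc (0:ℝ) 1, t ^ (-(1 / 2) : ℝ) :=
      setIntegral_nonneg measurableSet_Ioc fun t ht => Real.rpow_nonneg ht.1.le _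
    calc _ ≤ ν * Real.exp (2 * (√(ν ^ 2 - ν) - ν * saddle ν)) *
          (Real.exp (2 * ν) * ∫ t in Ioc (0:ℝ) 1, t ^ (-(1 / 2) : ℝ)) :=
          mul_le_mul_of_nonneg_left (integral_nicholson_Ioc_le hν) (by positivity)
      _ = ν * Real.exp (2 * (√(ν ^ 2 - ν) - ν * saddle ν) + 2 * ν) *
          ∫ t in Ioc (0:ℝ) 1, t ^ (-(1 / 2) : ℝ) := by
          rw [Real.exp_add]; ring
      _ ≤ _ := by
          refine mul_le_mul_of_nonneg_right (mul_le_mul_of_nonneg_left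
            (Real.exp_le_exp.2 ?_) (by linarith)) hI
          have hw : √(ν ^ 2 - ν) ≤ ν := Real.sqrt_le_iff.2 ⟨by linarith, by linarith⟩
          nlinarith

lemma tendsto_integral_nicholson :
    Tendsto (fun ν => ν * Real.exp (2 * (√(ν ^ 2 - ν) - ν * saddle ν)) *
      ∫ t in Ioi 0, nicholson ν t) atTop (nhds (π / 4)) := by
  have h := tendsto_integral_nicholson_Ioc.add tendsto_integral_rescaled
  rw [zero_add] at h
  refine h.congr' ?_
  filter_upwards [eventually_ge_atTop 2, eventually_two_add_saddle_le] with ν hν hs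
  rw [integral_rescaled (by linarith), ← mul_add, ← Ioc_union_Ioi_eq_Ioi zero_le_one,
    setIntegral_union (Ioc_disjoint_Ioi le_rfl) measurableSet_Ioi
      (integrableOn_nicholson_Ioc (by linarith)) (integrableOn_nicholson_Ioi_one hν hs)]

/-- Leading asymptotics of the Bessel modulus in the intermediate regime `z = √ν`. -/
theorem M_sqrt_regime :
    Tendsto (fun ν : ℝ =>
        Real.sqrt ν *
          Real.exp (Real.sqrt (ν ^ 2 - ν)
            - ν * Real.log (Real.sqrt ν + Real.sqrt (ν - 1))) *
          M ν (Real.sqrt ν)) atTop (nhds (Real.sqrt (2 / π))) := by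
  have h := (tendsto_integral_nicholson.const_mul (8 / π ^ 2)).sqrt
  rw [show 8 / π ^ 2 * (π / 4) = 2 / π by field_simp; norm_num] at h
  refine h.congr' ?_
  filter_upwards [eventually_ge_atTop 0] with ν hν
  have e : Real.exp (√(ν ^ 2 - ν) - ν * Real.log (√ν + √(ν - 1))) =
      √(Real.exp (2 * (√(ν ^ 2 - ν) - ν * saddle ν))) := by
    rw [← Real.exp_half, mul_div_cancel_left₀ _ two_ne_zero, saddle]
  rw [e, M, ← Real.sqrt_mul hν, ← Real.sqrt_mul (by positivity), M2]
  unfold nicholson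
  congr 1
  ring
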